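/- arXiv:2605.02514 — 3 statements merged into one kernel-verified Lean document; each statement's English description precedes it below -/
import Mathlib

section
/- Let W be a graphon on a probability space (Ω, 𝒜, μ), let φ : Ω' → Ω be a measurable measure-preserving map from a probability space (Ω', 𝒜', μ'), and let W^φ(x, y) = W(φ(x), φ(y)). Let T_W be the integral operator on L²(Ω, μ) with kernel W and T_{W^φ} the integral operator on L²(Ω', μ') with kernel W^φ. Then the spectra of T_W and T_{W^φ} coincide up to the multiplicity of the eigenvalue 0: for every λ ≠ 0, λ is an eigenvalue of T_W if and only if λ is an eigenvalue of T_{W^φ}, and in that case the corresponding eigenspaces have the same (finite) dimension. -/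
open MeasureTheory
open scoped Classical

/-- `W` is a graphon: a symmetric measurable function with values in `[0,1]`. -/
def IsGraphon {Ω : Type*} [MeasurableSpace Ω] (W : Ω → Ω → ℝ) : Prop :=
  Measurable (Function.uncurry W) ∧ (∀ x y, W x y = W y x) ∧
    ∀ x y, W x y ∈ Set.Icc (0 : ℝ) 1

/-- `lam` is an eigenvalue of the integral operator `T_W` on `L²(Ω, μ)`:
there is an `L²` eigenfunction, not a.e. zero, with `T_W f = lam • f` a.e. -/
def IsEigenvalue {Ω : Type*} [MeasurableSpace Ω] (μ : Measure Ω)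
    (W : Ω → Ω → ℝ) (lam : ℝ) : Prop :=
  ∃ f : Ω → ℝ, MemLp f 2 μ ∧ ¬ (f =ᵐ[μ] 0) ∧
    ∀ᵐ x ∂μ, (∫ y, W x y * f y ∂μ) = lam * f x

/-- The eigenspace of `T_W` for `lam` has dimension at least `n`: there are `n`
eigenfunctions in `L²(Ω, μ)` that are linearly independent modulo a.e. equality. -/
def HasEigenFamily {Ω : Type*} [MeasurableSpace Ω] (μ : Measure Ω)
    (W : Ω → Ω → ℝ) (lam : ℝ) (n : ℕ) : Prop :=
  ∃ f : Fin n → Ω → ℝ, (∀ i, MemLp (f i) 2 μ) ∧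
    (∀ i, ∀ᵐ x ∂μ, (∫ y, W x y * f i y ∂μ) = lam * f i x) ∧
    ∀ c : Fin n → ℝ, (∀ᵐ x ∂μ, (∑ i, c i * f i x) = 0) → c = 0

/-- An operator `T_W` has `lam` as an eigenvalue iff it has an eigenfamily of size one. -/
theorem isEigenvalue_iff_hasEigenFamily_one {Ω : Type*} [MeasurableSpace Ω] (μ : Measure Ω)
    (W : Ω → Ω → ℝ) (lam : ℝ) : IsEigenvalue μ W lam ↔ HasEigenFamily μ W lam 1 := by
  constructor
  · rintro ⟨f, hf, hf0, hfe⟩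
    refine ⟨fun _ => f, fun _ => hf, fun _ => hfe, fun c hc => ?_⟩
    by_contra hne
    have hc0 : c 0 ≠ 0 := fun h => hne (by ext i; rw [Subsingleton.elim i 0, h]; rfl)
    apply hf0
    filter_upwards [hc] with x hx
    simpa [hc0] using hx
  · rintro ⟨f, hf, hfe, hind⟩
    refine ⟨f 0, hf 0, fun h0 => ?_, hfe 0⟩
    have := hind (fun _ => 1) (by filter_upwards [h0] with x hx; simpa using hx)
    simpa using congrFun this 0

theorem integral_comp_of_measurePreserving {Ω Ω' : Type*} [MeasurableSpace Ω]
    [MeasurableSpace Ω'] {μ : Measure Ω} {μ' : Measure Ω'} {φ : Ω' → Ω}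
    (hφ : MeasurePreserving φ μ' μ) {g : Ω → ℝ} (hg : AEStronglyMeasurable g μ) :
    ∫ y, g (φ y) ∂μ' = ∫ z, g z ∂μ := by
  rw [← hφ.map_eq] at hg ⊢
  exact (integral_map hφ.measurable.aemeasurable hg).symm

theorem IsGraphon.measurable_section {Ω : Type*} [MeasurableSpace Ω] {W : Ω → Ω → ℝ}
    (hW : IsGraphon W) (x : Ω) : Measurable (W x) :=
  hW.1.comp measurable_prodMk_left

theorem IsGraphon.norm_le_one {Ω : Type*} [MeasurableSpace Ω] {W : Ω → Ω → ℝ}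
    (hW : IsGraphon W) (x y : Ω) : ‖W x y‖ ≤ 1 := by
  rw [Real.norm_eq_abs, abs_le]
  exact ⟨by linarith [(hW.2.2 x y).1], (hW.2.2 x y).2⟩

theorem IsGraphon.hasEigenFamily_pullback {Ω Ω' : Type*} [MeasurableSpace Ω]
    [MeasurableSpace Ω'] {μ : Measure Ω} {μ' : Measure Ω'} {W : Ω → Ω → ℝ} (hW : IsGraphon W)
    {φ : Ω' → Ω} (hφ : MeasurePreserving φ μ' μ) {lam : ℝ} {n : ℕ}
    (h : HasEigenFamily μ W lam n) :
    HasEigenFamily μ' (fun x y => W (φ x) (φ y)) lam n := by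
  obtain ⟨f, hf, hfe, hind⟩ := h
  refine ⟨fun i => f i ∘ φ, fun i => (hf i).comp_measurePreserving hφ, fun i => ?_,
    fun c hc => hind c ?_⟩
  · filter_upwards [hφ.quasiMeasurePreserving.ae (hfe i)] with x hx
    rw [Function.comp_apply, ← hx]
    exact integral_comp_of_measurePreserving hφ
      (g := fun z => W (φ x) z * f i z)
      ((hW.measurable_section _).aestronglyMeasurable.mul (hf i).1)
  · have hm : AEStronglyMeasurable (fun x => ∑ i, c i * f i x) μ :=
      Finset.aestronglyMeasurable_fun_sum _ fun i _ => (hf i).1.const_mul (c i)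
    have hz :=
      (hm.nullMeasurableSet_eq_fun (g := fun _ => (0 : ℝ)) aestronglyMeasurable_const).compl
    exact (hφ.measure_preimage hz).symm.trans (ae_iff.1 hc)

/-- An eigenfunction `g` of the pulled back operator descends to
`x ↦ lam⁻¹ * ∫ y, W x (φ y) * g y`. -/
theorem IsGraphon.hasEigenFamily_of_pullback {Ω Ω' : Type*} [MeasurableSpace Ω]
    [MeasurableSpace Ω'] {μ : Measure Ω} [IsFiniteMeasure μ] {μ' : Measure Ω'}
    [IsFiniteMeasure μ'] {W : Ω → Ω → ℝ} (hW : IsGraphon W)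
    {φ : Ω' → Ω} (hφ : MeasurePreserving φ μ' μ) {lam : ℝ} (hlam : lam ≠ 0) {n : ℕ}
    (h : HasEigenFamily μ' (fun x y => W (φ x) (φ y)) lam n) :
    HasEigenFamily μ W lam n := by
  obtain ⟨g, hg, hge, hind⟩ := h
  let f : Fin n → Ω → ℝ := fun i x => lam⁻¹ * ∫ y, W x (φ y) * g i y ∂μ'
  have hfm : ∀ i, AEStronglyMeasurable (f i) μ := fun i => by
    have h1 : Measurable fun p : Ω × Ω' => W p.1 (φ p.2) :=
      hW.1.comp (measurable_fst.prodMk (hφ.measurable.comp measurable_snd))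
    have h2 : AEStronglyMeasurable (fun p : Ω × Ω' => W p.1 (φ p.2) * g i p.2) (μ.prod μ') :=
      h1.aestronglyMeasurable.mul (hg i).1.comp_snd
    exact h2.integral_prod_right'.const_mul _
  have hfg : ∀ i, ∀ᵐ y ∂μ', f i (φ y) = g i y := fun i => by
    filter_upwards [hge i] with y hy
    simp only [f, hy]
    field_simp
  refine ⟨f, fun i => ?_, fun i => ?_, fun c hc => hind c ?_⟩
  · refine MemLp.of_bound (hfm i) (|lam⁻¹| * ∫ y, ‖g i y‖ ∂μ') (ae_of_all _ fun x => ?_)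
    rw [norm_mul, Real.norm_eq_abs lam⁻¹]
    gcongr
    refine norm_integral_le_of_norm_le ((hg i).integrable one_le_two).norm (ae_of_all _ fun y => ?_)
    rw [norm_mul]
    exact mul_le_of_le_one_left (norm_nonneg _) (hW.norm_le_one _ _)
  · refine ae_of_all _ fun x => ?_
    rw [← integral_comp_of_measurePreserving hφ
      (g := fun z => W x z * f i z)
      ((hW.measurable_section _).aestronglyMeasurable.mul (hfm i))]
    have : ∫ y, W x (φ y) * f i (φ y) ∂μ' = ∫ y, W x (φ y) * g i y ∂μ' :=
      integral_congr_ae (by filter_upwards [hfg i] with y hy; rw [hy])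
    rw [this]
    simp only [f]
    field_simp
  · filter_upwards [hφ.quasiMeasurePreserving.ae hc, ae_all_iff.2 hfg] with y hy hy'
    simpa [hy'] using hy

/-- The eigenfunctions of `T_W` for `lam`, as a subspace of `L²`. -/
noncomputable def IsGraphon.eigenspace {Ω : Type*} [MeasurableSpace Ω] {W : Ω → Ω → ℝ}
    (hW : IsGraphon W) (μ : Measure Ω) [IsFiniteMeasure μ] (lam : ℝ) :
    Submodule ℝ (Lp ℝ 2 μ) where
  carrier := {f | ∀ᵐ x ∂μ, (∫ y, W x y * f y ∂μ) = lam * f x}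
  zero_mem' := by
    have h0 := Lp.coeFn_zero ℝ 2 μ
    filter_upwards [h0] with x hx
    rw [hx, integral_congr_ae (g := fun _ => 0)]
    · simp
    · filter_upwards [h0] with y hy
      rw [hy, Pi.zero_apply, mul_zero]
  add_mem' := by
    intro f g hf hg
    have hi : ∀ (h : Lp ℝ 2 μ) (x : Ω), Integrable (fun y => W x y * h y) μ := fun h x =>
      ((Lp.memLp h).integrable one_le_two).bdd_mul
        (hW.measurable_section x).aestronglyMeasurable (ae_of_all _ (hW.norm_le_one x))
    have ha := Lp.coeFn_add f g
    rw [Set.mem_ofPred_eq] at hf hg ⊢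
    filter_upwards [ha, hf, hg] with x hx hfx hgx
    rw [hx, Pi.add_apply, mul_add, ← hfx, ← hgx, ← integral_add (hi f x) (hi g x)]
    refine integral_congr_ae ?_
    filter_upwards [ha] with y hy
    rw [hy, Pi.add_apply, mul_add]
  smul_mem' := by
    intro c f hf
    have hc := Lp.coeFn_smul c f
    rw [Set.mem_ofPred_eq] at hf ⊢
    filter_upwards [hc, hf] with x hx hfx
    rw [hx, Pi.smul_apply, smul_eq_mul, mul_left_comm, ← hfx, ← integral_const_mul]
    refine integral_congr_ae ?_
    filter_upwards [hc] with y hy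
    rw [hy, Pi.smul_apply, smul_eq_mul, mul_left_comm]

/-- Bessel's inequality applied to the sections `W x` bounds the size of an orthonormal family
of eigenfunctions. -/
theorem IsGraphon.card_mul_sq_le_one_of_orthonormal {Ω : Type*} [MeasurableSpace Ω]
    {W : Ω → Ω → ℝ} (hW : IsGraphon W) {μ : Measure Ω} [IsProbabilityMeasure μ] {lam : ℝ}
    {ι : Type*} [Fintype ι] {e : ι → Lp ℝ 2 μ} (he : Orthonormal ℝ e)
    (hmem : ∀ i, e i ∈ hW.eigenspace μ lam) : Fintype.card ι * lam ^ 2 ≤ 1 := by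
  have hsec : ∀ x, MemLp (W x) 2 μ := fun x =>
    MemLp.of_bound (hW.measurable_section x).aestronglyMeasurable 1
      (ae_of_all _ (hW.norm_le_one x))
  have hbessel : ∀ x, ∑ i, (∫ y, W x y * e i y ∂μ) ^ 2 ≤ 1 := fun x => by
    have h1 : ‖(hsec x).toLp‖ ≤ 1 := by
      refine (Lp.norm_le_of_ae_bound zero_le_one ?_).trans_eq (by simp [measureUnivNNReal])
      filter_upwards [(hsec x).coeFn_toLp] with y hy
      rw [hy]
      exact hW.norm_le_one x y
    have h2 : ∀ i, inner ℝ (e i) (hsec x).toLp = ∫ y, W x y * e i y ∂μ := fun i => by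
      rw [L2.inner_def]
      refine integral_congr_ae ?_
      filter_upwards [(hsec x).coeFn_toLp] with y hy
      simp [hy]
    have h3 := he.sum_inner_products_le (hsec x).toLp (s := Finset.univ)
    simp only [h2, Real.norm_eq_abs, sq_abs] at h3
    exact h3.trans (pow_le_one₀ (norm_nonneg _) h1)
  have hint : ∀ i, Integrable (fun x => (e i x) ^ 2) μ := fun i => (Lp.memLp (e i)).integrable_sq
  have hnorm : ∀ i, ∫ x, (e i x) ^ 2 ∂μ = 1 := fun i => by
    have := real_inner_self_eq_norm_sq (e i)
    rw [he.1 i, L2.inner_def] at this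
    simpa [sq] using this
  calc (Fintype.card ι : ℝ) * lam ^ 2 = ∫ x, ∑ i, lam ^ 2 * (e i x) ^ 2 ∂μ := by
        rw [integral_finsetSum _ fun i _ => (hint i).const_mul _]
        simp [integral_const_mul, hnorm]
    _ ≤ ∫ _, (1 : ℝ) ∂μ := by
        refine integral_mono_ae (integrable_finsetSum _ fun i _ => (hint i).const_mul _)
          (integrable_const _) ?_
        filter_upwards [ae_all_iff.2 hmem] with x hx
        have := hbessel x
        simpa only [hx, mul_pow] using this
    _ = 1 := by simp

theorem IsGraphon.mul_sq_le_one_of_hasEigenFamily {Ω : Type*} [MeasurableSpace Ω]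
    {W : Ω → Ω → ℝ} (hW : IsGraphon W) {μ : Measure Ω} [IsProbabilityMeasure μ] {lam : ℝ}
    {n : ℕ} (h : HasEigenFamily μ W lam n) : n * lam ^ 2 ≤ 1 := by
  obtain ⟨f, hf, hfe, hind⟩ := h
  let F : Fin n → Lp ℝ 2 μ := fun i => (hf i).toLp
  have hFf : ∀ᵐ x ∂μ, ∀ i, F i x = f i x := ae_all_iff.2 fun i => (hf i).coeFn_toLp
  have hF : LinearIndependent ℝ F := by
    rw [Fintype.linearIndependent_iff]
    intro c hc
    refine congrFun (hind c ?_)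
    have h1 : ∀ᵐ x ∂μ, ∀ i, (c i • F i : Lp ℝ 2 μ) x = c i * F i x :=
      ae_all_iff.2 fun i => Lp.coeFn_smul (c i) (F i)
    have h2 := Lp.coeFn_finsetSum Finset.univ fun i => c i • F i
    rw [hc] at h2
    filter_upwards [h1, h2, hFf, Lp.coeFn_zero ℝ 2 μ] with x hx1 hx2 hx3 hx4
    rw [hx4] at hx2
    simpa [hx1, hx3] using hx2.symm
  have hmem : ∀ i, F i ∈ hW.eigenspace μ lam := fun i => by
    filter_upwards [hfe i, hFf] with x hx hxF
    rw [hxF, ← hx]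
    refine integral_congr_ae ?_
    filter_upwards [hFf] with y hy
    rw [hy]
  have hspan : Submodule.span ℝ (Set.range F) ≤ hW.eigenspace μ lam :=
    Submodule.span_le.2 (Set.range_subset_iff.2 hmem)
  have hfin : FiniteDimensional ℝ (Submodule.span ℝ (Set.range F)) :=
    FiniteDimensional.span_of_finite ℝ (Set.finite_range F)
  let b := stdOrthonormalBasis ℝ (Submodule.span ℝ (Set.range F))
  have hb := hW.card_mul_sq_le_one_of_orthonormal
    (b.orthonormal.comp_linearIsometry (Submodule.span ℝ (Set.range F)).subtypeₗᵢ)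
    fun i => hspan (b i).2
  simpa [finrank_span_eq_card hF] using hb

/-- if `φ` is measure preserving and `W^φ(x,y) = W(φ x, φ y)`, then the
spectra of `T_W` and `T_{W^φ}` coincide up to the multiplicity of the eigenvalue `0`:
every `lam ≠ 0` is an eigenvalue of `T_W` iff it is one of `T_{W^φ}`, the corresponding
eigenspaces have the same dimension, and this dimension is finite. -/
theorem spectrum_invariant_under_measurePreserving_pullback
    {Ω : Type*} [MeasurableSpace Ω] (μ : Measure Ω) [IsProbabilityMeasure μ]
    {Ω' : Type*} [MeasurableSpace Ω'] (μ' : Measure Ω') [IsProbabilityMeasure μ']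
    (W : Ω → Ω → ℝ) (hW : IsGraphon W)
    (φ : Ω' → Ω) (hφ : MeasurePreserving φ μ' μ) :
    ∀ lam : ℝ, lam ≠ 0 →
      (IsEigenvalue μ W lam ↔ IsEigenvalue μ' (fun x y => W (φ x) (φ y)) lam) ∧
      (∀ n : ℕ, HasEigenFamily μ W lam n ↔
        HasEigenFamily μ' (fun x y => W (φ x) (φ y)) lam n) ∧
      (IsEigenvalue μ W lam →
        ∃ n : ℕ, HasEigenFamily μ W lam n ∧ ¬ HasEigenFamily μ W lam (n + 1)) := by
  intro lam hlam
  have hiff : ∀ n : ℕ, HasEigenFamily μ W lam n ↔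
      HasEigenFamily μ' (fun x y => W (φ x) (φ y)) lam n := fun n =>
    ⟨hW.hasEigenFamily_pullback hφ, hW.hasEigenFamily_of_pullback hφ hlam⟩
  refine ⟨?_, hiff, fun _ => ?_⟩
  · rw [isEigenvalue_iff_hasEigenFamily_one, isEigenvalue_iff_hasEigenFamily_one]
    exact hiff 1
  · by_contra! hstep
    have hall : ∀ n, HasEigenFamily μ W lam n := fun n => by
      induction n with
      | zero => exact ⟨Fin.elim0, fun i => i.elim0, fun i => i.elim0,
          fun c _ => Subsingleton.elim _ _⟩
      | succ k ih => exact hstep k ih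
    have hpos : 0 < lam ^ 2 := by positivity
    obtain ⟨n, hn⟩ := exists_nat_gt (1 / lam ^ 2)
    rw [div_lt_iff₀ hpos] at hn
    exact absurd (hW.mul_sq_le_one_of_hasEigenFamily (hall n)) hn.not_ge
end

section
/- Let σ be the uniform probability measure on the unit sphere S³ ⊂ ℝ⁴ and let W_{S³}(x, y) = 1/2 + (1/4)·⟨x, y⟩. Then for the integral operator T_{W_{S³}} on L²(S³, σ): the constant function 1 is an eigenfunction with eigenvalue 1/2; the four coordinate functions y ↦ y_i (i = 1, …, 4) are eigenfunctions with eigenvalue 1/16; T_{W_{S³}} vanishes on the orthogonal complement of the span of these five functions. Consequently the nonzero spectrum of T_{W_{S³}} is {1/2, 1/16}, where 1/2 has a 1-dimensional eigenspace and 1/16 has a 4-dimensional eigenspace. -/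
open MeasureTheory
open scoped RealInnerProductSpace

/-- The uniform (normalized surface) probability measure on the unit sphere of a Euclidean
space. -/
noncomputable def sphereUniform (d : ℕ) :
    Measure (Metric.sphere (0 : EuclideanSpace ℝ (Fin d)) 1) :=
  (((volume : Measure (EuclideanSpace ℝ (Fin d))).toSphere Set.univ)⁻¹) •
    (volume : Measure (EuclideanSpace ℝ (Fin d))).toSphere

/-- The graphon `W_{S³}(x,y) = 1/2 + (1/4)⟨x,y⟩` on the sphere `S³ ⊂ ℝ⁴`. -/
noncomputable def WS3 (x y : Metric.sphere (0 : EuclideanSpace ℝ (Fin 4)) 1) : ℝ :=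
  1 / 2 + (1 / 4) * ⟪(x : EuclideanSpace ℝ (Fin 4)), (y : EuclideanSpace ℝ (Fin 4))⟫

/-- The map of the unit sphere induced by a linear isometry equivalence. -/
def sphereIsometry {E : Type*} [NormedAddCommGroup E] [NormedSpace ℝ E] (L : E ≃ₗᵢ[ℝ] E)
    (x : Metric.sphere (0 : E) 1) : Metric.sphere (0 : E) 1 :=
  ⟨L x, by simp⟩

open scoped Pointwise in
/-- A measure-preserving linear isometry equivalence preserves the induced measure on the
unit sphere. -/
theorem measurePreserving_sphereIsometry {E : Type*} [NormedAddCommGroup E] [NormedSpace ℝ E]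
    [MeasurableSpace E] [BorelSpace E] {μ : Measure E} (L : E ≃ₗᵢ[ℝ] E)
    (hL : MeasurePreserving L μ μ) :
    MeasurePreserving (sphereIsometry L) μ.toSphere μ.toSphere := by
  have hmeas : Measurable (sphereIsometry L) :=
    (L.continuous.measurable.comp measurable_subtype_coe).subtype_mk
  refine ⟨hmeas, Measure.ext fun s hs ↦ ?_⟩
  rw [Measure.map_apply hmeas hs, Measure.toSphere_apply' _ hs,
    Measure.toSphere_apply' _ (hmeas hs)]
  congr 1
  have key : Set.Ioo (0 : ℝ) 1 • ((↑) '' (sphereIsometry L ⁻¹' s)) =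
      L ⁻¹' (Set.Ioo (0 : ℝ) 1 • (((↑) : Metric.sphere (0 : E) 1 → E) '' s)) := by
    ext x
    simp only [Set.mem_smul, Set.mem_preimage, Set.mem_image]
    constructor
    · rintro ⟨r, hr, _, ⟨y, hy, rfl⟩, rfl⟩
      exact ⟨r, hr, L y, ⟨sphereIsometry L y, hy, rfl⟩, by simp⟩
    · rintro ⟨r, hr, _, ⟨y, hy, rfl⟩, h⟩
      refine ⟨r, hr, L.symm y, ⟨sphereIsometry L.symm y, ?_, rfl⟩, ?_⟩
      · have : sphereIsometry L (sphereIsometry L.symm y) = y :=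
          Subtype.ext (L.apply_symm_apply y)
        simpa [this] using hy
      · rw [← map_smul, h, L.symm_apply_apply]
  rw [key]
  exact hL.measure_preimage_emb L.toHomeomorph.measurableEmbedding _

local notation "𝕊" d => Metric.sphere (0 : EuclideanSpace ℝ (Fin d)) 1

section SphereUniform

variable {d : ℕ}

instance sphereUniform.instIsProbabilityMeasure [NeZero d] :
    IsProbabilityMeasure (sphereUniform d) := by
  have h : (volume : Measure (EuclideanSpace ℝ (Fin d))).toSphere Set.univ ≠ 0 := by
    have hball := Metric.measure_ball_pos volume (0 : EuclideanSpace ℝ (Fin d)) one_pos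
    simp [NeZero.ne d, hball.ne']
  refine ⟨?_⟩
  rw [sphereUniform, Measure.smul_apply, smul_eq_mul]
  exact ENNReal.inv_mul_cancel h (measure_ne_top _ _)

theorem integral_sphereIsometry (L : EuclideanSpace ℝ (Fin d) ≃ₗᵢ[ℝ] EuclideanSpace ℝ (Fin d))
    (f : (𝕊 d) → ℝ) :
    ∫ y, f (sphereIsometry L y) ∂sphereUniform d = ∫ y, f y ∂sphereUniform d := by
  have hemb : MeasurableEmbedding (sphereIsometry L) := by
    refine Topology.IsClosedEmbedding.measurableEmbedding
      (Continuous.isClosedEmbedding ?_ fun x y h ↦ ?_)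
    · exact (L.continuous.comp continuous_subtype_val).subtype_mk _
    · exact Subtype.ext (L.injective (congrArg Subtype.val h))
  rw [sphereUniform, integral_smul_measure, integral_smul_measure,
    (measurePreserving_sphereIsometry L L.measurePreserving).integral_comp hemb]

/-- The linear isometry changing the sign of the `i`-th coordinate. -/
noncomputable def coordNeg (i : Fin d) :
    EuclideanSpace ℝ (Fin d) ≃ₗᵢ[ℝ] EuclideanSpace ℝ (Fin d) :=
  LinearIsometryEquiv.piLpCongrRight 2 fun j ↦
    if j = i then LinearIsometryEquiv.neg ℝ else LinearIsometryEquiv.refl ℝ ℝ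

theorem coordNeg_apply_self (i : Fin d) (x : EuclideanSpace ℝ (Fin d)) :
    coordNeg i x i = -x i := by
  simp [coordNeg]

theorem coordNeg_apply_of_ne {i j : Fin d} (h : j ≠ i) (x : EuclideanSpace ℝ (Fin d)) :
    coordNeg i x j = x j := by
  simp [coordNeg, h]

theorem integral_coord (i : Fin d) :
    ∫ y : 𝕊 d, (y : EuclideanSpace ℝ (Fin d)) i ∂sphereUniform d = 0 := by
  have h := integral_sphereIsometry (coordNeg i) fun y ↦ (y : EuclideanSpace ℝ (Fin d)) i
  simp only [sphereIsometry, coordNeg_apply_self, integral_neg] at h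
  linarith

theorem integral_coord_mul_coord_of_ne {i j : Fin d} (hij : i ≠ j) :
    ∫ y : 𝕊 d, (y : EuclideanSpace ℝ (Fin d)) i * (y : EuclideanSpace ℝ (Fin d)) j
      ∂sphereUniform d = 0 := by
  have h := integral_sphereIsometry (coordNeg i) fun y ↦
    (y : EuclideanSpace ℝ (Fin d)) i * (y : EuclideanSpace ℝ (Fin d)) j
  simp only [sphereIsometry, coordNeg_apply_self, coordNeg_apply_of_ne hij.symm, neg_mul,
    integral_neg] at h
  linarith

theorem continuous_coord (i : Fin d) :
    Continuous fun y : 𝕊 d ↦ (y : EuclideanSpace ℝ (Fin d)) i := by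
  fun_prop

theorem abs_coord_le_one (i : Fin d) (y : 𝕊 d) : |(y : EuclideanSpace ℝ (Fin d)) i| ≤ 1 := by
  simpa using PiLp.norm_apply_le (y : EuclideanSpace ℝ (Fin d)) i

theorem MeasureTheory.Integrable.mul_coord {f : (𝕊 d) → ℝ} (hf : Integrable f (sphereUniform d))
    (i : Fin d) :
    Integrable (fun y ↦ f y * (y : EuclideanSpace ℝ (Fin d)) i) (sphereUniform d) :=
  hf.mul_bdd (c := 1) (continuous_coord i).aestronglyMeasurable
    (.of_forall fun y ↦ abs_coord_le_one i y)

variable [NeZero d]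

theorem memLp_coord (i : Fin d) :
    MemLp (fun y : 𝕊 d ↦ (y : EuclideanSpace ℝ (Fin d)) i) 2 (sphereUniform d) :=
  MemLp.of_bound (continuous_coord i).aestronglyMeasurable 1
    (.of_forall fun y ↦ abs_coord_le_one i y)

theorem integrable_coord (i : Fin d) :
    Integrable (fun y : 𝕊 d ↦ (y : EuclideanSpace ℝ (Fin d)) i) (sphereUniform d) :=
  (memLp_coord i).integrable (by norm_num)

theorem integral_coord_mul_coord_self (i : Fin d) :
    ∫ y : 𝕊 d, (y : EuclideanSpace ℝ (Fin d)) i * (y : EuclideanSpace ℝ (Fin d)) i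
      ∂sphereUniform d = 1 / d := by
  have hsymm (j : Fin d) :
      ∫ y : 𝕊 d, (y : EuclideanSpace ℝ (Fin d)) j * (y : EuclideanSpace ℝ (Fin d)) j
        ∂sphereUniform d =
      ∫ y : 𝕊 d, (y : EuclideanSpace ℝ (Fin d)) i * (y : EuclideanSpace ℝ (Fin d)) i
        ∂sphereUniform d := by
    rw [← integral_sphereIsometry
      (LinearIsometryEquiv.piLpCongrLeft 2 ℝ ℝ (Equiv.swap i j)) fun y ↦
        (y : EuclideanSpace ℝ (Fin d)) j * (y : EuclideanSpace ℝ (Fin d)) j]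
    simp [sphereIsometry, LinearIsometryEquiv.piLpCongrLeft_apply, Equiv.piCongrLeft'_apply]
  have hsum : ∑ j : Fin d,
      ∫ y : 𝕊 d, (y : EuclideanSpace ℝ (Fin d)) j * (y : EuclideanSpace ℝ (Fin d)) j
        ∂sphereUniform d = 1 := by
    rw [← integral_finsetSum _ fun j _ ↦ (integrable_coord j).mul_coord j]
    have h1 (y : 𝕊 d) :
        ∑ j, (y : EuclideanSpace ℝ (Fin d)) j * (y : EuclideanSpace ℝ (Fin d)) j = 1 := by
      have h := EuclideanSpace.real_norm_sq_eq (y : EuclideanSpace ℝ (Fin d))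
      rw [norm_eq_of_mem_sphere y] at h
      simpa [sq] using h.symm
    simp [h1]
  simp only [hsymm, Finset.sum_const, Finset.card_univ, Fintype.card_fin, nsmul_eq_mul] at hsum
  rw [eq_div_iff (NeZero.ne _), mul_comm, hsum]

theorem integral_coord_mul_coord (i j : Fin d) :
    ∫ y : 𝕊 d, (y : EuclideanSpace ℝ (Fin d)) i * (y : EuclideanSpace ℝ (Fin d)) j
      ∂sphereUniform d = if i = j then 1 / (d : ℝ) else 0 := by
  split_ifs with h
  · subst h
    exact integral_coord_mul_coord_self i
  · exact integral_coord_mul_coord_of_ne h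

/-- The mean of an affine function over the sphere. -/
theorem integral_affine (a : ℝ) (b : Fin d → ℝ) :
    ∫ y : 𝕊 d, (a + ∑ i, b i * (y : EuclideanSpace ℝ (Fin d)) i) ∂sphereUniform d = a := by
  rw [integral_add (integrable_const _)
    (integrable_finsetSum _ fun i _ ↦ (integrable_coord i).const_mul _),
    integral_finsetSum _ fun i _ ↦ (integrable_coord i).const_mul _]
  simp [integral_const_mul, integral_coord]

/-- The correlation of an affine function with a coordinate. -/
theorem integral_affine_mul_coord (a : ℝ) (b : Fin d → ℝ) (j : Fin d) :
    ∫ y : 𝕊 d, (a + ∑ i, b i * (y : EuclideanSpace ℝ (Fin d)) i) *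
      (y : EuclideanSpace ℝ (Fin d)) j ∂sphereUniform d = b j / d := by
  simp only [add_mul, Finset.sum_mul, mul_assoc]
  rw [integral_add ((integrable_coord j).const_mul _)
    (integrable_finsetSum _ fun i _ ↦ ((integrable_coord i).mul_coord j).const_mul _),
    integral_finsetSum _ fun i _ ↦ ((integrable_coord i).mul_coord j).const_mul _]
  simp [integral_const_mul, integral_coord, integral_coord_mul_coord, div_eq_mul_inv]

end SphereUniform

section Operator

/-- The operator `T_{W_{S³}}` takes values in the affine functions. -/
theorem integral_WS3_mul {f : (𝕊 4) → ℝ} (hf : Integrable f (sphereUniform 4)) (x : 𝕊 4) :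
    ∫ y, WS3 x y * f y ∂sphereUniform 4 =
      (1 / 2) * ∫ y, f y ∂sphereUniform 4 +
        ∑ i, (1 / 4 * ∫ y, f y * (y : EuclideanSpace ℝ (Fin 4)) i ∂sphereUniform 4) *
          (x : EuclideanSpace ℝ (Fin 4)) i := by
  have h (y : 𝕊 4) : WS3 x y * f y = 1 / 2 * f y +
      ∑ i, (1 / 4 * (x : EuclideanSpace ℝ (Fin 4)) i) *
        (f y * (y : EuclideanSpace ℝ (Fin 4)) i) := by
    simp only [WS3, PiLp.inner_apply, RCLike.inner_apply, conj_trivial, Fin.sum_univ_four]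
    ring
  simp only [h]
  rw [integral_add (hf.const_mul _) (integrable_finsetSum _ fun i _ ↦ (hf.mul_coord i).const_mul _),
    integral_finsetSum _ fun i _ ↦ (hf.mul_coord i).const_mul _]
  simp only [integral_const_mul]
  congr 1
  exact Finset.sum_congr rfl fun i _ ↦ by ring

theorem integral_WS3_mul_one (x : 𝕊 4) : ∫ y, WS3 x y * 1 ∂sphereUniform 4 = 1 / 2 * 1 := by
  rw [integral_WS3_mul (integrable_const _)]
  simp [integral_coord]

theorem integral_WS3_mul_coord (i : Fin 4) (x : 𝕊 4) :
    ∫ y, WS3 x y * (y : EuclideanSpace ℝ (Fin 4)) i ∂sphereUniform 4 =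
      1 / 16 * (x : EuclideanSpace ℝ (Fin 4)) i := by
  rw [integral_WS3_mul (integrable_coord i)]
  simp only [integral_coord, integral_coord_mul_coord, mul_ite, ite_mul, mul_zero, zero_mul,
    Finset.sum_ite_eq, Finset.mem_univ, if_true, zero_add, Nat.cast_ofNat]
  ring

theorem eigenfunction_mean {f : (𝕊 4) → ℝ} {lam : ℝ} (hf : MemLp f 2 (sphereUniform 4))
    (h : ∀ᵐ x ∂sphereUniform 4, (∫ y, WS3 x y * f y ∂sphereUniform 4) = lam * f x) :
    lam * ∫ y, f y ∂sphereUniform 4 = 1 / 2 * ∫ y, f y ∂sphereUniform 4 := by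
  simp only [integral_WS3_mul (hf.integrable one_le_two)] at h
  rw [← integral_const_mul, ← integral_congr_ae h, integral_affine]

theorem eigenfunction_coord {f : (𝕊 4) → ℝ} {lam : ℝ} (hf : MemLp f 2 (sphereUniform 4))
    (h : ∀ᵐ x ∂sphereUniform 4, (∫ y, WS3 x y * f y ∂sphereUniform 4) = lam * f x)
    (i : Fin 4) :
    lam * ∫ y, f y * (y : EuclideanSpace ℝ (Fin 4)) i ∂sphereUniform 4 =
      1 / 16 * ∫ y, f y * (y : EuclideanSpace ℝ (Fin 4)) i ∂sphereUniform 4 := by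
  simp only [integral_WS3_mul (hf.integrable one_le_two)] at h
  rw [← integral_const_mul]
  simp only [← mul_assoc]
  rw [← integral_congr_ae (h.mono fun x hx ↦
    congrArg (· * (x : EuclideanSpace ℝ (Fin 4)) i) hx), integral_affine_mul_coord]
  push_cast
  ring

/-- An eigenfunction for a nonzero eigenvalue that is orthogonal to the affine functions
vanishes almost everywhere. -/
theorem eigenfunction_eq_zero {f : (𝕊 4) → ℝ} {lam : ℝ} (hlam : lam ≠ 0)
    (hf : MemLp f 2 (sphereUniform 4))
    (h : ∀ᵐ x ∂sphereUniform 4, (∫ y, WS3 x y * f y ∂sphereUniform 4) = lam * f x)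
    (h0 : ∫ y, f y ∂sphereUniform 4 = 0)
    (h1 : ∀ i : Fin 4, ∫ y, f y * (y : EuclideanSpace ℝ (Fin 4)) i ∂sphereUniform 4 = 0) :
    f =ᵐ[sphereUniform 4] 0 := by
  filter_upwards [h] with x hx
  rw [integral_WS3_mul (hf.integrable one_le_two)] at hx
  simpa [h0, h1, hlam] using hx.symm

theorem isEigenvalue_WS3_iff {lam : ℝ} (hlam : lam ≠ 0) :
    IsEigenvalue (sphereUniform 4) WS3 lam ↔ lam = 1 / 2 ∨ lam = 1 / 16 := by
  constructor
  · rintro ⟨f, hf, hne, h⟩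
    by_contra! hcon
    refine hne (eigenfunction_eq_zero hlam hf h ?_ fun i ↦ ?_)
    · by_contra h0
      exact hcon.1 (mul_right_cancel₀ h0 (eigenfunction_mean hf h))
    · by_contra h1
      exact hcon.2 (mul_right_cancel₀ h1 (eigenfunction_coord hf h i))
  · rintro (rfl | rfl)
    · refine ⟨fun _ ↦ 1, memLp_const _, fun h ↦ ?_, .of_forall integral_WS3_mul_one⟩
      simpa using integral_congr_ae h
    · refine ⟨fun y ↦ (y : EuclideanSpace ℝ (Fin 4)) 0, memLp_coord 0, fun h ↦ ?_,
        .of_forall (integral_WS3_mul_coord 0)⟩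
      have h1 := integral_congr_ae (h.mul (Filter.EventuallyEq.refl _
        fun y : 𝕊 4 ↦ (y : EuclideanSpace ℝ (Fin 4)) 0))
      simp [integral_coord_mul_coord_self] at h1

/-- The eigenspace dimension is bounded by the dimension of the target of a family of
functionals jointly injective on the eigenspace. -/
theorem not_hasEigenFamily_of_functionals {m n : ℕ} (hmn : m < n) {lam : ℝ} (φ : Fin m → (𝕊 4) → ℝ)
    (hφ : ∀ (f : (𝕊 4) → ℝ) (k : Fin m), MemLp f 2 (sphereUniform 4) →
      Integrable (fun y ↦ f y * φ k y) (sphereUniform 4))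
    (hinj : ∀ f : (𝕊 4) → ℝ, MemLp f 2 (sphereUniform 4) →
      (∀ᵐ x ∂sphereUniform 4, (∫ y, WS3 x y * f y ∂sphereUniform 4) = lam * f x) →
      (∀ k, ∫ y, f y * φ k y ∂sphereUniform 4 = 0) → f =ᵐ[sphereUniform 4] 0) :
    ¬ HasEigenFamily (sphereUniform 4) WS3 lam n := by
  rintro ⟨f, hf, hT, hind⟩
  let A : Matrix (Fin m) (Fin n) ℝ := .of fun k i ↦ ∫ y, f i y * φ k y ∂sphereUniform 4
  obtain ⟨c, hc, hc0⟩ := Submodule.exists_mem_ne_zero_of_ne_bot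
    (LinearMap.ker_ne_bot_of_finrank_lt (f := A.mulVecLin) (by simpa using hmn))
  refine hc0 (hind c (hinj (fun x ↦ ∑ i, c i * f i x)
    (memLp_finsetSum _ fun i _ ↦ (hf i).const_mul _) ?_ fun k ↦ ?_))
  · filter_upwards [ae_all_iff.2 hT] with x hx
    have hint (i : Fin n) : Integrable (fun y ↦ WS3 x y * f i y) (sphereUniform 4) := by
      have hW : Continuous fun y ↦ WS3 x y := by unfold WS3; fun_prop
      refine ((hf i).integrable one_le_two).bdd_mul (c := 1) hW.aestronglyMeasurable
        (.of_forall fun y ↦ ?_)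
      have := abs_real_inner_le_norm (x : EuclideanSpace ℝ (Fin 4)) y
      rw [norm_eq_of_mem_sphere x, norm_eq_of_mem_sphere y, abs_le] at this
      rw [Real.norm_eq_abs, abs_le, WS3]
      constructor <;> linarith
    simp only [Finset.mul_sum, mul_left_comm _ (c _)]
    rw [integral_finsetSum _ fun i _ ↦ (hint i).const_mul _]
    simp only [integral_const_mul, hx]
  · simp only [Finset.sum_mul, mul_assoc]
    rw [integral_finsetSum _ fun i _ ↦ (hφ _ k (hf i)).const_mul _]
    have := congrFun (LinearMap.mem_ker.1 hc) k
    simpa [A, Matrix.mulVec, dotProduct, integral_const_mul, mul_comm] using this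

end Operator

/-- spectral decomposition of the sphere graphon `W_{S³} = 1/2 + (1/4)⟨x,y⟩`:
the constant `1` is an eigenfunction with eigenvalue `1/2`; the four coordinate functions
are eigenfunctions with eigenvalue `1/16`; `T_{W_{S³}}` vanishes on the orthogonal
complement of these five functions; consequently the nonzero spectrum is `{1/2, 1/16}`
with eigenspaces of dimensions `1` and `4` respectively. -/
theorem WS3_spectrum :
    let S := Metric.sphere (0 : EuclideanSpace ℝ (Fin 4)) 1
    let σ := sphereUniform 4
    let coord : Fin 4 → S → ℝ := fun i y => (y : EuclideanSpace ℝ (Fin 4)) i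
    (∀ x : S, (∫ y, WS3 x y * 1 ∂σ) = (1 / 2) * 1) ∧
    (∀ i : Fin 4, ∀ x : S, (∫ y, WS3 x y * coord i y ∂σ) = (1 / 16) * coord i x) ∧
    (∀ g : S → ℝ, MemLp g 2 σ → (∫ y, g y ∂σ) = 0 →
      (∀ i : Fin 4, (∫ y, g y * coord i y ∂σ) = 0) →
      ∀ x : S, (∫ y, WS3 x y * g y ∂σ) = 0) ∧
    (∀ lam : ℝ, lam ≠ 0 → (IsEigenvalue σ WS3 lam ↔ lam = 1 / 2 ∨ lam = 1 / 16)) ∧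
    HasEigenFamily σ WS3 (1 / 2) 1 ∧ ¬ HasEigenFamily σ WS3 (1 / 2) 2 ∧
    HasEigenFamily σ WS3 (1 / 16) 4 ∧ ¬ HasEigenFamily σ WS3 (1 / 16) 5 := by
  intro S σ coord
  refine ⟨integral_WS3_mul_one, integral_WS3_mul_coord, fun g hg h0 h1 x ↦ ?_,
    fun lam hlam ↦ isEigenvalue_WS3_iff hlam, ?_, ?_, ?_, ?_⟩
  · rw [integral_WS3_mul (hg.integrable one_le_two), h0]
    simp only [coord, σ, S] at h1
    simp only [h1]
    simp
  · refine ⟨fun _ _ ↦ 1, fun _ ↦ memLp_const _, fun _ ↦ .of_forall integral_WS3_mul_one,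
      fun c hc ↦ ?_⟩
    have h := integral_congr_ae hc
    ext i
    fin_cases i
    simpa using h
  · refine not_hasEigenFamily_of_functionals one_lt_two (fun _ _ ↦ 1)
      (fun f _ hf ↦ by simpa using hf.integrable one_le_two) fun f hf hT h0 ↦ ?_
    refine eigenfunction_eq_zero (by norm_num) hf hT (by simpa using h0 0) fun i ↦ ?_
    linarith [eigenfunction_coord hf hT i]
  · refine ⟨coord, memLp_coord, fun i ↦ .of_forall (integral_WS3_mul_coord i), fun c hc ↦ ?_⟩
    ext j
    have h := integral_affine_mul_coord 0 c j
    have hz : (fun y : S ↦ (0 + ∑ i, c i * (y : EuclideanSpace ℝ (Fin 4)) i) *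
        (y : EuclideanSpace ℝ (Fin 4)) j) =ᵐ[σ] 0 := by
      filter_upwards [hc] with y hy
      simp only [coord] at hy
      simp [hy]
    rw [integral_congr_ae hz] at h
    simpa using h.symm
  · refine not_hasEigenFamily_of_functionals (Nat.lt_succ_self 4) coord
      (fun f k hf ↦ (hf.integrable one_le_two).mul_coord k) fun f hf hT h1 ↦ ?_
    refine eigenfunction_eq_zero (by norm_num) hf hT ?_ h1
    linarith [eigenfunction_mean hf hT]
end

section
/- There exist probability spaces (Ω₁, μ₁) and (Ω₂, μ₂) and graphons W₁ on Ω₁ and W₂ on Ω₂ such that the associated integral operators T_{W₁} and T_{W₂} are isospectral (they have the same spectrum and, for every nonzero eigenvalue, eigenspaces of equal dimension), yet W₁ and W₂ are not weakly isomorphic (there is a finite simple graph F with t(F, W₁) ≠ t(F, W₂)). In particular, the spectrum of a graphon does not determine the graphon up to weak isomorphism. -/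
/-- A graphon together with its underlying probability space: a symmetric measurable
function `W : Ω × Ω → [0,1]` on a probability space `(Ω, μ)`. -/
structure ProbGraphon where
  space : Type
  [inst : MeasurableSpace space]
  μ : MeasureTheory.Measure space
  prob : MeasureTheory.IsProbabilityMeasure μ
  W : space → space → ℝ
  meas : Measurable (Function.uncurry W)
  symm : ∀ x y, W x y = W y x
  range : ∀ x y, W x y ∈ Set.Icc (0 : ℝ) 1

attribute [instance] ProbGraphon.inst

open MeasureTheory
open scoped Classical

/-- `lam` is an eigenvalue of the integral operator `T_W` on `L²(Ω, μ)`. -/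
def ProbGraphon.IsEigenvalue (G : ProbGraphon) (lam : ℝ) : Prop :=
  ∃ f : G.space → ℝ, MemLp f 2 G.μ ∧ ¬ (f =ᵐ[G.μ] 0) ∧
    ∀ᵐ x ∂G.μ, (∫ y, G.W x y * f y ∂G.μ) = lam * f x

/-- The eigenspace of `T_W` for `lam` has dimension at least `n`. -/
def ProbGraphon.HasEigenFamily (G : ProbGraphon) (lam : ℝ) (n : ℕ) : Prop :=
  ∃ f : Fin n → G.space → ℝ, (∀ i, MemLp (f i) 2 G.μ) ∧
    (∀ i, ∀ᵐ x ∂G.μ, (∫ y, G.W x y * f i y ∂G.μ) = lam * f i x) ∧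
    ∀ c : Fin n → ℝ, (∀ᵐ x ∂G.μ, (∑ i, c i * f i x) = 0) → c = 0

/-- The homomorphism density `t(F, W)` of a finite simple graph `F` (on `Fin m`). -/
noncomputable def ProbGraphon.homDensity (G : ProbGraphon) {m : ℕ}
    (F : SimpleGraph (Fin m)) : ℝ :=
  ∫ x : Fin m → G.space,
    ∏ p ∈ Finset.univ.filter (fun p : Fin m × Fin m => p.1 < p.2 ∧ F.Adj p.1 p.2),
      G.W (x p.1) (x p.2) ∂(Measure.pi fun _ : Fin m => G.μ)

/-- The uniform probability measure on `Bool`. -/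
noncomputable def boolUniform : Measure Bool :=
  (2⁻¹ : ENNReal) • (Measure.dirac true + Measure.dirac false)

instance isProbabilityMeasure_boolUniform : IsProbabilityMeasure boolUniform := by
  constructor
  simp only [boolUniform, Measure.smul_apply, Measure.add_apply, measure_univ, smul_eq_mul]
  rw [one_add_one_eq_two, ENNReal.inv_mul_cancel] <;> norm_num

lemma boolUniform_singleton (b : Bool) : boolUniform {b} = 2⁻¹ := by
  cases b <;> simp [boolUniform]

lemma integral_boolUniform (f : Bool → ℝ) :
    ∫ x, f x ∂boolUniform = (f true + f false) / 2 := by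
  rw [integral_fintype .of_finite]
  simp [measureReal_def, boolUniform_singleton]
  ring

lemma ae_boolUniform_iff {p : Bool → Prop} : (∀ᵐ x ∂boolUniform, p x) ↔ ∀ x, p x := by
  rw [ae_iff_of_countable]
  simp [boolUniform_singleton]

lemma memLp_boolUniform (f : Bool → ℝ) : MemLp f 2 boolUniform :=
  .of_discrete

/-- The graphon on two points of mass `1 / 2` given by a symmetric `2 × 2` matrix. -/
noncomputable def boolGraphon (W : Bool → Bool → ℝ) (symm : ∀ x y, W x y = W y x)
    (range : ∀ x y, W x y ∈ Set.Icc (0 : ℝ) 1) : ProbGraphon where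
  space := Bool
  μ := boolUniform
  prob := inferInstance
  W := W
  meas := measurable_of_countable _
  symm := symm
  range := range

section Isospectral

variable {W W' : Bool → Bool → ℝ} {symm : ∀ x y, W x y = W y x}
  {range : ∀ x y, W x y ∈ Set.Icc (0 : ℝ) 1} {symm' : ∀ x y, W' x y = W' y x}
  {range' : ∀ x y, W' x y ∈ Set.Icc (0 : ℝ) 1}

lemma isEigenvalue_boolGraphon_iff {lam : ℝ} :
    (boolGraphon W symm range).IsEigenvalue lam ↔
      ∃ f : Bool → ℝ, f ≠ 0 ∧
        ∀ x, (W x true * f true + W x false * f false) / 2 = lam * f x := by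
  change (∃ f : Bool → ℝ, MemLp f 2 boolUniform ∧ ¬ (∀ᵐ x ∂boolUniform, f x = 0) ∧
    ∀ᵐ x ∂boolUniform, (∫ y, W x y * f y ∂boolUniform) = lam * f x) ↔ _
  simp only [ae_boolUniform_iff, integral_boolUniform, memLp_boolUniform, true_and, ne_eq,
    funext_iff, Pi.zero_apply]

lemma hasEigenFamily_boolGraphon_iff {lam : ℝ} {n : ℕ} :
    (boolGraphon W symm range).HasEigenFamily lam n ↔
      ∃ f : Fin n → Bool → ℝ,
        (∀ i x, (W x true * f i true + W x false * f i false) / 2 = lam * f i x) ∧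
        LinearIndependent ℝ f := by
  change (∃ f : Fin n → Bool → ℝ, (∀ i, MemLp (f i) 2 boolUniform) ∧
    (∀ i, ∀ᵐ x ∂boolUniform, (∫ y, W x y * f i y ∂boolUniform) = lam * f i x) ∧
    ∀ c : Fin n → ℝ, (∀ᵐ x ∂boolUniform, (∑ i, c i * f i x) = 0) → c = 0) ↔ _
  simp only [ae_boolUniform_iff, integral_boolUniform, memLp_boolUniform, implies_true, true_and,
    Fintype.linearIndependent_iff, funext_iff, Pi.zero_apply, Finset.sum_apply, Pi.smul_apply,
    smul_eq_mul]

/-- An injective linear map that intertwines the two integral operators transports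
eigenvalues. -/
lemma IsEigenvalue.of_intertwining {lam : ℝ} (V : (Bool → ℝ) →ₗ[ℝ] (Bool → ℝ))
    (hV : Function.Injective V)
    (h : ∀ f, (fun x ↦ (W' x true * V f true + W' x false * V f false) / 2) =
      V fun x ↦ (W x true * f true + W x false * f false) / 2)
    (hlam : (boolGraphon W symm range).IsEigenvalue lam) :
    (boolGraphon W' symm' range').IsEigenvalue lam := by
  rw [isEigenvalue_boolGraphon_iff] at hlam ⊢
  obtain ⟨f, hf, hfe⟩ := hlam
  refine ⟨V f, (map_ne_zero_iff V hV).2 hf, congrFun ?_⟩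
  rw [h, show (fun x ↦ (W x true * f true + W x false * f false) / 2) = lam • f from funext hfe,
    map_smul]
  rfl

/-- An injective linear map that intertwines the two integral operators transports linearly
independent families of eigenfunctions. -/
lemma HasEigenFamily.of_intertwining {lam : ℝ} {n : ℕ} (V : (Bool → ℝ) →ₗ[ℝ] (Bool → ℝ))
    (hV : Function.Injective V)
    (h : ∀ f, (fun x ↦ (W' x true * V f true + W' x false * V f false) / 2) =
      V fun x ↦ (W x true * f true + W x false * f false) / 2)
    (hlam : (boolGraphon W symm range).HasEigenFamily lam n) :
    (boolGraphon W' symm' range').HasEigenFamily lam n := by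
  rw [hasEigenFamily_boolGraphon_iff] at hlam ⊢
  obtain ⟨f, hfe, hf⟩ := hlam
  refine ⟨fun i ↦ V (f i), fun i ↦ congrFun ?_, hf.map' V (LinearMap.ker_eq_bot.2 hV)⟩
  rw [h, show (fun x ↦ (W x true * f i true + W x false * f i false) / 2) = lam • f i from
    funext (hfe i), map_smul]
  rfl

lemma homDensity_top_boolGraphon :
    (boolGraphon W symm range).homDensity (⊤ : SimpleGraph (Fin 2)) =
      (W true true + W true false + W false true + W false false) / 4 := by
  have hE (F : SimpleGraph (Fin 2)) (hF : F = ⊤) :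
      Finset.univ.filter (fun p : Fin 2 × Fin 2 ↦ p.1 < p.2 ∧ F.Adj p.1 p.2) = {(0, 1)} := by
    subst hF
    ext ⟨a, b⟩
    fin_cases a <;> fin_cases b <;> simp
  have hD (F : SimpleGraph (Fin 2)) : (boolGraphon W symm range).homDensity F =
      ∫ x : Fin 2 → Bool, ∏ p ∈ Finset.univ.filter
        (fun p : Fin 2 × Fin 2 ↦ p.1 < p.2 ∧ F.Adj p.1 p.2), W (x p.1) (x p.2)
          ∂(Measure.pi fun _ : Fin 2 ↦ boolUniform) := rfl
  rw [hD, hE _ rfl]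
  simp only [Finset.prod_singleton]
  rw [integral_fintype .of_finite, ← (finTwoArrowEquiv Bool).symm.sum_comp,
    Fintype.sum_prod_type]
  simp [measureReal_def, Measure.pi_singleton, boolUniform_singleton]
  ring

end Isospectral

/-- The sum-and-difference transform on functions on two points. -/
def sumDiff : (Bool → ℝ) →ₗ[ℝ] (Bool → ℝ) where
  toFun f x := if x then f true + f false else f true - f false
  map_add' f g := by ext (_ | _) <;> simp <;> ring
  map_smul' c f := by ext (_ | _) <;> simp <;> ring

lemma sumDiff_injective : Function.Injective sumDiff := by
  intro f g h
  have h₁ : f true + f false = g true + g false := congrFun h true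
  have h₂ : f true - f false = g true - g false := congrFun h false
  ext (_ | _) <;> linarith

/-- there exist two graphons, on suitable probability spaces, whose integral
operators are isospectral (same eigenvalues and, for every nonzero eigenvalue, eigenspaces
of equal dimension), but which are not weakly isomorphic: some finite simple graph has
different homomorphism densities in the two graphons. Hence the spectrum of a graphon does
not determine it up to weak isomorphism. -/
theorem exists_isospectral_not_weaklyIsomorphic_graphons :
    ∃ G₁ G₂ : ProbGraphon,
      (∀ lam : ℝ, G₁.IsEigenvalue lam ↔ G₂.IsEigenvalue lam) ∧
      (∀ lam : ℝ, lam ≠ 0 → ∀ n : ℕ, G₁.HasEigenFamily lam n ↔ G₂.HasEigenFamily lam n) ∧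
      (∃ (m : ℕ) (F : SimpleGraph (Fin m)), G₁.homDensity F ≠ G₂.homDensity F) := by
  let G₁ := boolGraphon (fun _ _ ↦ 1 / 2) (fun _ _ ↦ rfl) (fun _ _ ↦ by norm_num)
  let G₂ := boolGraphon (fun x y ↦ if x && y then 1 else 0) (fun x y ↦ by rw [Bool.and_comm])
    (fun x y ↦ by split_ifs <;> norm_num)
  have h₁₂ (f : Bool → ℝ) :
      (fun x ↦ ((if x && true then 1 else 0) * sumDiff f true +
        (if x && false then 1 else 0) * sumDiff f false) / 2) =
      sumDiff fun _ ↦ (1 / 2 * f true + 1 / 2 * f false) / 2 := by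
    ext (_ | _) <;> simp [sumDiff]
    ring
  have h₂₁ (f : Bool → ℝ) :
      (fun _ : Bool ↦ (1 / 2 * sumDiff f true + 1 / 2 * sumDiff f false) / 2) =
      sumDiff fun x ↦ ((if x && true then 1 else 0) * f true +
        (if x && false then 1 else 0) * f false) / 2 := by
    ext (_ | _) <;> simp [sumDiff] <;> ring
  refine ⟨G₁, G₂, fun lam ↦ ⟨?_, ?_⟩, fun lam _ n ↦ ⟨?_, ?_⟩, 2, ⊤, ?_⟩
  · exact IsEigenvalue.of_intertwining sumDiff sumDiff_injective h₁₂
  · exact IsEigenvalue.of_intertwining sumDiff sumDiff_injective h₂₁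
  · exact HasEigenFamily.of_intertwining sumDiff sumDiff_injective h₁₂
  · exact HasEigenFamily.of_intertwining sumDiff sumDiff_injective h₂₁
  · rw [homDensity_top_boolGraphon, homDensity_top_boolGraphon]
    norm_num
end
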